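/- (Whitney Extension Theorem, infinite order.) Let U ⊆ ℝⁿ be open and X ⊆ U relatively closed and nonempty. Let F = (F_α)_{α ∈ ℕⁿ} be a family of continuous functions F_α : X → ℝ such that for every m ∈ ℕ the truncation (F_α)_{|α| ≤ m} is a Whitney function of class m on X. Then there exists f ∈ C^∞(U,ℝ) such that ∂^α f(x) = F_α(x) for every x ∈ X and every multi-index α ∈ ℕⁿ. -/

import Mathlib

noncomputable section

/-- The Taylor remainder `(R^m_x F)_β (y)` of an `m`-jet
`F = (F_α)_{α}` on `ℝⁿ`:  `F_β y - ∑_{|α| ≤ m - |β|} F_{α+β} x · (y-x)^α / α!`. -/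
def taylorRem {n : ℕ} (m : ℕ) (F : (Fin n → ℕ) → EuclideanSpace ℝ (Fin n) → ℝ)
    (β : Fin n → ℕ) (x y : EuclideanSpace ℝ (Fin n)) : ℝ :=
  F β y - ∑ α ∈ (Finset.Iic (fun _ => m - ∑ i, β i : Fin n → ℕ)).filter
      (fun α => ∑ i, α i ≤ m - ∑ i, β i),
    (F (α + β) x * ∏ i, (y i - x i) ^ α i) / ∏ i, ((α i).factorial : ℝ)

/-- `F` is a Whitney function of class `m` on `X`: the components `F_β`, `|β| ≤ m`, are continuous
on `X` and for every compact `K ⊆ X` one has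
`(R^m_x F)_β (y) = o(|x - y|^(m - |β|))` uniformly on `K × K`. -/
def IsWhitney {n : ℕ} (m : ℕ) (X : Set (EuclideanSpace ℝ (Fin n)))
    (F : (Fin n → ℕ) → EuclideanSpace ℝ (Fin n) → ℝ) : Prop :=
  (∀ β : Fin n → ℕ, (∑ i, β i) ≤ m → ContinuousOn (F β) X) ∧
  ∀ K : Set (EuclideanSpace ℝ (Fin n)), IsCompact K → K ⊆ X →
    ∀ β : Fin n → ℕ, (∑ i, β i) ≤ m →
    ∀ ε > (0:ℝ), ∃ δ > (0:ℝ), ∀ x ∈ K, ∀ y ∈ K, 0 < dist x y → dist x y ≤ δ →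
      |taylorRem m F β x y| ≤ ε * dist x y ^ (m - ∑ i, β i)

open Filter Topology

/-- Multi-indices of order at most `m`. -/
def multiIdx (n m : ℕ) : Finset (Fin n → ℕ) :=
  (Finset.Iic (fun _ => m : Fin n → ℕ)).filter (fun α => ∑ i, α i ≤ m)

/-- The polynomial `∑_{|α| ≤ m} c_α v^α / α!`. -/
def taylorPoly {n : ℕ} (m : ℕ) (c : (Fin n → ℕ) → ℝ) (v : EuclideanSpace ℝ (Fin n)) : ℝ :=
  ∑ α ∈ multiIdx n m, (c α * ∏ i, v i ^ α i) / ∏ i, ((α i).factorial : ℝ)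

/-- The multi-index counting the occurrences of each coordinate in `j`. -/
def countIdx {n k : ℕ} (j : Fin k → Fin n) : Fin n → ℕ :=
  fun i => (Finset.univ.filter (fun l => j l = i)).card

lemma mem_multiIdx {n m : ℕ} {α : Fin n → ℕ} : α ∈ multiIdx n m ↔ ∑ i, α i ≤ m := by
  simp only [multiIdx, Finset.mem_filter, Finset.mem_Iic, and_iff_right_iff_imp]
  intro h i
  exact (Finset.single_le_sum (fun i _ => Nat.zero_le (α i)) (Finset.mem_univ i)).trans h

lemma taylorRem_eq {n : ℕ} (m : ℕ) (F : (Fin n → ℕ) → EuclideanSpace ℝ (Fin n) → ℝ)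
    (β : Fin n → ℕ) (x y : EuclideanSpace ℝ (Fin n)) :
    taylorRem m F β x y
      = F β y - taylorPoly (m - ∑ i, β i) (fun α => F (α + β) x) (y - x) := by
  simp [taylorRem, taylorPoly, multiIdx]

lemma card_multiIdx_le (n m : ℕ) : (multiIdx n m).card ≤ (m + 1) ^ n := by
  refine (Finset.card_filter_le _ _).trans ?_
  rw [← Fin.prod_const]
  simp [Pi.card_Iic]

lemma contDiff_taylorPoly {n : ℕ} (m : ℕ) (c : (Fin n → ℕ) → ℝ)
    (x : EuclideanSpace ℝ (Fin n)) :
    ContDiff ℝ (⊤ : ℕ∞) (fun y => taylorPoly m c (y - x)) := by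
  unfold taylorPoly
  refine ContDiff.sum fun α _ => ContDiff.div_const (ContDiff.mul contDiff_const ?_) _
  exact contDiff_prod fun i _ => by fun_prop

lemma taylorPoly_zero {n : ℕ} (m : ℕ) (c : (Fin n → ℕ) → ℝ) :
    taylorPoly m c 0 = c 0 := by
  unfold taylorPoly
  rw [Finset.sum_eq_single 0]
  · simp
  · intro α _ hα
    obtain ⟨i, hi⟩ := Function.ne_iff.1 hα
    rw [Finset.prod_eq_zero (Finset.mem_univ i)] <;> simp_all
  · intro h
    exact absurd (mem_multiIdx.2 (by simp)) h

lemma abs_taylorPoly_le {n : ℕ} (m : ℕ) (c : (Fin n → ℕ) → ℝ) (v : EuclideanSpace ℝ (Fin n))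
    (hv : ‖v‖ ≤ 1) {A : ℝ} (hA : 0 ≤ A) (hc : ∀ α, |c α| ≤ A) :
    |taylorPoly m c v| ≤ ((m : ℝ) + 1) ^ n * A := by
  unfold taylorPoly
  refine (Finset.abs_sum_le_sum_abs _ _).trans ?_
  have h1 : ∀ α ∈ multiIdx n m, |(c α * ∏ i, v i ^ α i) / ∏ i, ((α i).factorial : ℝ)| ≤ A := by
    intro α _
    rw [abs_div, abs_mul, Finset.abs_prod, Finset.abs_prod]
    have h2 : ∏ i, |v i ^ α i| ≤ 1 := by
      refine Finset.prod_le_one (fun _ _ => abs_nonneg _) fun i _ => ?_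
      rw [abs_pow]
      exact pow_le_one₀ (abs_nonneg _) ((PiLp.norm_apply_le v i).trans hv)
    have h3 : 1 ≤ ∏ i, |((α i).factorial : ℝ)| := by
      simp only [Nat.abs_cast]
      exact_mod_cast Finset.prod_pos fun i _ => Nat.factorial_pos (α i)
    rw [div_le_iff₀ (by linarith)]
    have h4 : 0 ≤ ∏ i, |v i ^ α i| := Finset.prod_nonneg fun _ _ => abs_nonneg _
    calc |c α| * ∏ i, |v i ^ α i| ≤ A * 1 := by gcongr; exact hc α
      _ ≤ A * _ := by gcongr
  refine (Finset.sum_le_card_nsmul _ _ _ h1).trans ?_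
  rw [nsmul_eq_mul]
  gcongr
  exact_mod_cast card_multiIdx_le n m

lemma fderiv_monomial_single {n : ℕ} (α : Fin n → ℕ) (i : Fin n)
    (v : EuclideanSpace ℝ (Fin n)) :
    fderiv ℝ (fun v : EuclideanSpace ℝ (Fin n) => ∏ l, v l ^ α l) v (EuclideanSpace.single i 1)
      = α i * ∏ l, v l ^ (α - Pi.single i 1 : Fin n → ℕ) l := by
  have h : ∀ l ∈ (Finset.univ : Finset (Fin n)),
      HasFDerivAt (fun v : EuclideanSpace ℝ (Fin n) => v l ^ α l)
        ((α l * v l ^ (α l - 1)) • (EuclideanSpace.proj l : EuclideanSpace ℝ (Fin n) →L[ℝ] ℝ)) v := by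
    intro l _
    have := (EuclideanSpace.proj l : EuclideanSpace ℝ (Fin n) →L[ℝ] ℝ).hasFDerivAt (x := v)
    simpa using this.pow (α l)
  rw [(HasFDerivAt.finsetProd h).fderiv, sum_apply,
    Finset.sum_eq_single i]
  · rw [← Finset.mul_prod_erase _ _ (Finset.mem_univ i)]
    simp only [smul_apply, smul_eq_mul, PiLp.proj_apply]
    have : ∏ l ∈ Finset.univ.erase i, v l ^ (α - Pi.single i 1 : Fin n → ℕ) l
        = ∏ l ∈ Finset.univ.erase i, v l ^ α l := by
      refine Finset.prod_congr rfl fun l hl => ?_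
      simp [(Finset.mem_erase.1 hl).1]
    rw [this]
    simp
    ring
  · intro l _ hl
    simp [hl]
  · simp

lemma fderiv_taylorPoly_single {n : ℕ} (m : ℕ) (c : (Fin n → ℕ) → ℝ)
    (x y : EuclideanSpace ℝ (Fin n)) (i : Fin n) :
    fderiv ℝ (fun y => taylorPoly m c (y - x)) y (EuclideanSpace.single i 1)
      = if 1 ≤ m then taylorPoly (m - 1) (fun α => c (α + Pi.single i 1)) (y - x) else 0 := by
  rw [fderiv_comp_sub (f := taylorPoly m c)]
  unfold taylorPoly
  have hd : ∀ α : Fin n → ℕ, DifferentiableAt ℝ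
      (fun v : EuclideanSpace ℝ (Fin n) => ∏ l, v l ^ α l) (y - x) := by
    intro α
    fun_prop
  have hd' : ∀ α ∈ multiIdx n m, DifferentiableAt ℝ (fun v : EuclideanSpace ℝ (Fin n) =>
      (c α * ∏ l, v l ^ α l) / ∏ l, ((α l).factorial : ℝ)) (y - x) := by
    intro α _
    simp only [div_eq_mul_inv]
    exact ((hd α).const_mul _).mul_const _
  rw [fderiv_fun_sum hd', sum_apply]
  have h1 : ∀ α ∈ multiIdx n m, (fderiv ℝ (fun v : EuclideanSpace ℝ (Fin n) =>
      (c α * ∏ l, v l ^ α l) / ∏ l, ((α l).factorial : ℝ)) (y - x)) (EuclideanSpace.single i 1)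
      = c α * (α i * ∏ l, (y - x) l ^ (α - Pi.single i 1 : Fin n → ℕ) l) / ∏ l, ((α l).factorial : ℝ) := by
    intro α _
    simp only [div_eq_mul_inv]
    rw [fderiv_mul_const ((hd α).const_mul _), fderiv_const_mul (hd α),
      smul_apply, smul_apply, fderiv_monomial_single]
    simp only [smul_eq_mul]
    ring
  rw [Finset.sum_congr rfl h1]
  split_ifs with hm
  · rw [← Finset.sum_filter_add_sum_filter_not _ (fun α => α i = 0),
      Finset.sum_eq_zero (by intro α hα; simp [(Finset.mem_filter.1 hα).2]), zero_add]
    symm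
    refine Finset.sum_nbij' (fun α => α + Pi.single i 1) (fun α => α - Pi.single i 1) ?_ ?_ ?_ ?_ ?_
    · intro α hα
      rw [mem_multiIdx] at hα
      simp only [Finset.mem_filter, mem_multiIdx, Pi.add_apply, Finset.sum_add_distrib]
      simp
      omega
    · intro α hα
      simp only [Finset.mem_filter, mem_multiIdx] at hα ⊢
      have : Pi.single i 1 ≤ α := by
        intro l
        rcases eq_or_ne l i with rfl | hl
        · simp; omega
        · simp [hl]
      have h2 : ∑ l, (α - Pi.single i 1 : Fin n → ℕ) l + ∑ l, (Pi.single i 1 : Fin n → ℕ) l = ∑ l, α l := by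
        rw [← Finset.sum_add_distrib, ← tsub_add_cancel_of_le this]
        simp
      simp at h2 ⊢
      omega
    · intro α _
      simp
    · intro α hα
      simp only [Finset.mem_filter, mem_multiIdx] at hα
      refine tsub_add_cancel_of_le ?_
      intro l
      rcases eq_or_ne l i with rfl | hl
      · simp; omega
      · simp [hl]
    · intro α _
      rw [add_tsub_cancel_right]
      have h3 : ∏ l, (((α + Pi.single i 1 : Fin n → ℕ) l).factorial : ℝ)
          = (α i + 1) * ∏ l, ((α l).factorial : ℝ) := by
        rw [← Finset.mul_prod_erase _ _ (Finset.mem_univ i),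
          ← Finset.mul_prod_erase _ (fun l => ((α l).factorial : ℝ)) (Finset.mem_univ i),
          Finset.prod_congr rfl (g := fun l => ((α l).factorial : ℝ))]
        · simp [Nat.factorial_succ]
          ring
        · intro l hl
          simp [(Finset.mem_erase.1 hl).1]
      rw [h3]
      have h4 : ∏ l, ((α l).factorial : ℝ) ≠ 0 :=
        Finset.prod_ne_zero_iff.2 fun l _ => by exact_mod_cast Nat.factorial_ne_zero _
      have h5 : (α i : ℝ) + 1 ≠ 0 := by positivity
      simp
      field_simp
  · refine Finset.sum_eq_zero fun α hα => ?_
    rw [mem_multiIdx] at hα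
    have : α i = 0 := by
      have := (Finset.single_le_sum (fun i _ => Nat.zero_le (α i)) (Finset.mem_univ i)).trans hα
      omega
    simp [this]

lemma countIdx_snoc {n k : ℕ} (j : Fin (k + 1) → Fin n) :
    countIdx j = countIdx (fun l => j l.castSucc) + Pi.single (j (Fin.last k)) 1 := by
  ext i
  simp only [countIdx, Pi.add_apply, Finset.card_filter]
  rw [Fin.sum_univ_castSucc]
  congr 1
  simp [Pi.single_apply, eq_comm]

lemma sum_countIdx {n k : ℕ} (j : Fin k → Fin n) : ∑ i, countIdx j i = k := by
  simp only [countIdx]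
  rw [← Finset.card_eq_sum_card_fiberwise (fun l _ => Finset.mem_coe.2 (Finset.mem_univ (j l)))]
  simp

lemma iteratedFDeriv_taylorPoly {n : ℕ} (k m : ℕ) (c : (Fin n → ℕ) → ℝ)
    (x y : EuclideanSpace ℝ (Fin n)) (j : Fin k → Fin n) :
    iteratedFDeriv ℝ k (fun y => taylorPoly m c (y - x)) y
        (fun l => EuclideanSpace.single (j l) 1)
      = if k ≤ m then taylorPoly (m - k) (fun α => c (α + countIdx j)) (y - x) else 0 := by
  induction k generalizing m c with
  | zero =>
    have : countIdx j = 0 := by ext; simp [countIdx]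
    simp [this]
  | succ k ih =>
    rw [iteratedFDeriv_succ_apply_right, ← iteratedFDeriv_clm_apply_const_apply (n := ((⊤ : ℕ∞) : WithTop ℕ∞))]
    · simp only [fderiv_taylorPoly_single]
      by_cases hm : 1 ≤ m
      · simp only [hm, if_true]
        have := ih (m - 1) (fun α => c (α + Pi.single (j (Fin.last k)) 1)) (fun l => j l.castSucc)
        simp only [Fin.init_def]
        rw [this]
        have e : k ≤ m - 1 ↔ k + 1 ≤ m := by omega
        simp only [e, countIdx_snoc j, add_assoc, Nat.sub_sub, add_comm 1 k]
      · have : ¬ (k + 1 ≤ m) := by omega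
        simp only [hm, if_false, this]
        simp
    · exact (contDiff_taylorPoly m c x).fderiv_right (m := (⊤ : ℕ∞)) (by simp)
    · exact_mod_cast le_top

lemma norm_le_sum_single {n k : ℕ}
    (T : ContinuousMultilinearMap ℝ (fun _ : Fin k => EuclideanSpace ℝ (Fin n)) ℝ) {A : ℝ}
    (hT : ∀ j : Fin k → Fin n, |T (fun l => EuclideanSpace.single (j l) 1)| ≤ A) (hA : 0 ≤ A) :
    ‖T‖ ≤ (n : ℝ) ^ k * A := by
  refine ContinuousMultilinearMap.opNorm_le_bound (by positivity) fun v => ?_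
  have hv : v = fun l => ∑ i, v l i • EuclideanSpace.single i (1 : ℝ) := by
    funext l
    ext i
    simp [Finset.sum_apply, Pi.single_apply]
  have hs : T v = ∑ j : Fin k → Fin n,
      (∏ l, v l (j l)) * T (fun l => EuclideanSpace.single (j l) 1) := by
    conv_lhs => rw [hv]
    rw [ContinuousMultilinearMap.map_sum]
    refine Finset.sum_congr rfl fun j _ => ?_
    rw [ContinuousMultilinearMap.map_smul_univ, smul_eq_mul]
  rw [hs]
  refine (norm_sum_le _ _).trans ?_
  have h1 : ∀ j ∈ (Finset.univ : Finset (Fin k → Fin n)),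
      ‖(∏ l, v l (j l)) * T (fun l => EuclideanSpace.single (j l) 1)‖ ≤ A * ∏ l, ‖v l‖ := by
    intro j _
    rw [norm_mul, norm_prod, mul_comm]
    gcongr with l
    · exact hT j
    · exact PiLp.norm_apply_le _ _
  refine (Finset.sum_le_card_nsmul _ _ _ h1).trans (le_of_eq ?_)
  simp [mul_assoc]

lemma natCast_lt_infty (m : ℕ) : (m : WithTop ℕ∞) < ((⊤ : ℕ∞) : WithTop ℕ∞) := by
  rw [← WithTop.coe_natCast, WithTop.coe_lt_coe]
  exact ENat.natCast_lt_top m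

section
variable {E : Type*} [NormedAddCommGroup E] [NormedSpace ℝ E]

/-- Bounds on the derivatives at the centre of a ball and on the top order derivative throughout
the ball propagate to all derivatives on the ball. -/
lemma norm_iteratedFDeriv_le_of_center {g : E → ℝ} (hg : ContDiff ℝ (⊤ : ℕ∞) g) {x : E} {r A : ℝ}
    (hr : 0 ≤ r) (hA : 0 ≤ A) {L : ℕ}
    (hx : ∀ i < L, ‖iteratedFDeriv ℝ i g x‖ ≤ A * r ^ (L - i))
    (hL : ∀ y, dist y x ≤ r → ‖iteratedFDeriv ℝ L g y‖ ≤ A) {d : ℕ} (hd : d ≤ L) {y : E}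
    (hy : dist y x ≤ r) :
    ‖iteratedFDeriv ℝ (L - d) g y‖ ≤ 2 ^ d * A * r ^ d := by
  induction d generalizing y with
  | zero => simpa using hL y hy
  | succ d ih =>
    have hdL : L - (d + 1) + 1 = L - d := by omega
    have hdiff : Differentiable ℝ (iteratedFDeriv ℝ (L - (d + 1)) g) :=
      hg.differentiable_iteratedFDeriv (natCast_lt_infty _)
    have hmv := (convex_closedBall x r).norm_image_sub_le_of_norm_fderiv_le (𝕜 := ℝ)
      (f := iteratedFDeriv ℝ (L - (d + 1)) g) (C := 2 ^ d * A * r ^ d)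
      (fun z _ => hdiff z) (fun z hz => by
        rw [norm_fderiv_iteratedFDeriv, hdL]
        exact ih (by omega) (Metric.mem_closedBall.1 hz))
      (Metric.mem_closedBall_self hr) (Metric.mem_closedBall.2 hy)
    have h1 := hx (L - (d + 1)) (by omega)
    rw [show L - (L - (d + 1)) = d + 1 by omega] at h1
    have h2 : ‖iteratedFDeriv ℝ (L - (d + 1)) g y‖ ≤ ‖iteratedFDeriv ℝ (L - (d + 1)) g x‖
        + ‖iteratedFDeriv ℝ (L - (d + 1)) g y - iteratedFDeriv ℝ (L - (d + 1)) g x‖ :=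
      norm_le_norm_add_norm_sub' _ _
    rw [← dist_eq_norm y x] at hmv
    have h3 : 2 ^ d * A * r ^ d * dist y x ≤ 2 ^ d * A * r ^ d * r := by gcongr
    have h4 : A * r ^ (d + 1) ≤ 2 ^ d * (A * r ^ (d + 1)) :=
      le_mul_of_one_le_left (by positivity) (one_le_pow₀ (by norm_num))
    calc _ ≤ A * r ^ (d + 1) + 2 ^ d * A * r ^ d * r := by linarith
      _ ≤ 2 ^ d * (A * r ^ (d + 1)) + 2 ^ d * A * r ^ d * r := by linarith
      _ = 2 ^ (d + 1) * A * r ^ (d + 1) := by ring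

/-- A series of smooth functions, each of whose derivatives is eventually dominated by `2⁻ᵏ` on a
ball, is smooth there and can be differentiated termwise. -/
lemma smooth_tsum_ball [ProperSpace E] {h : ℕ → E → ℝ} (hh : ∀ k, ContDiff ℝ (⊤ : ℕ∞) (h k))
    {p : E} {ρ : ℝ} (hρ : 0 < ρ)
    (hb : ∀ j : ℕ, ∀ᶠ k in atTop, ∀ y ∈ Metric.ball p ρ, ‖iteratedFDeriv ℝ j (h k) y‖ ≤ (1 / 2) ^ k) :
    ContDiffOn ℝ (⊤ : ℕ∞) (fun y => ∑' k, h k y) (Metric.ball p ρ) ∧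
    ∀ j, ∀ y ∈ Metric.ball p ρ, HasSum (fun k => iteratedFDeriv ℝ j (h k) y)
      (iteratedFDeriv ℝ j (fun y => ∑' k, h k y) y) := by
  have hu : ∀ j : ℕ, ∃ u : ℕ → ℝ, Summable u ∧
      ∀ k, ∀ y ∈ Metric.ball p ρ, ‖iteratedFDeriv ℝ j (h k) y‖ ≤ u k := by
    intro j
    obtain ⟨k0, hk0⟩ := eventually_atTop.1 (hb j)
    have hC : ∀ k, ∃ C, ∀ y ∈ Metric.closedBall p ρ, ‖iteratedFDeriv ℝ j (h k) y‖ ≤ C := fun k =>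
      (isCompact_closedBall p ρ).exists_bound_of_continuousOn
        ((hh k).continuous_iteratedFDeriv (by exact_mod_cast le_top)).continuousOn
    choose C hC using hC
    refine ⟨fun k => if k < k0 then C k else (1 / 2) ^ k, ?_, fun k y hy => ?_⟩
    · rw [← summable_nat_add_iff k0]
      simpa using (summable_nat_add_iff k0).2 summable_geometric_two
    · dsimp only
      split_ifs with hk
      · exact hC k y (Metric.ball_subset_closedBall hy)
      · exact hk0 k (not_lt.1 hk) y hy
  choose u hus hub using hu
  have hsum : ∀ j, ∀ y ∈ Metric.ball p ρ, Summable (fun k => iteratedFDeriv ℝ j (h k) y) :=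
    fun j y hy => .of_norm_bounded (hus j) fun k => hub j k y hy
  have hp0 : p ∈ Metric.ball p ρ := Metric.mem_ball_self hρ
  have hT : HasFTaylorSeriesUpToOn (⊤ : ℕ∞) (fun y => ∑' k, h k y)
      (fun y j => ∑' k, iteratedFDeriv ℝ j (h k) y) (Metric.ball p ρ) := by
    have hder : ∀ m : ℕ, ∀ x ∈ Metric.ball p ρ,
        HasFDerivAt (fun y => ∑' k, iteratedFDeriv ℝ m (h k) y)
          (∑' k, iteratedFDeriv ℝ (m + 1) (h k) x).curryLeft x := by
      intro m x hx
      have := hasFDerivAt_tsum_of_isPreconnected (𝕜 := ℝ) (hus (m + 1)) Metric.isOpen_ball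
        (convex_ball p ρ).isPreconnected (f := fun k => iteratedFDeriv ℝ m (h k))
        (f' := fun k => fderiv ℝ (iteratedFDeriv ℝ m (h k)))
        (fun k y _ => ((hh k).differentiable_iteratedFDeriv
          (natCast_lt_infty _) y).hasFDerivAt)
        (fun k y hy => by rw [norm_fderiv_iteratedFDeriv]; exact hub (m + 1) k y hy)
        hp0 (hsum m p hp0) hx
      convert! this using 1
      have h1 : ∀ k, fderiv ℝ (iteratedFDeriv ℝ m (h k)) x
          = continuousMultilinearCurryLeftEquiv ℝ (fun _ : Fin (m + 1) => E) ℝ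
            (iteratedFDeriv ℝ (m + 1) (h k) x) := by
        intro k
        rw [fderiv_iteratedFDeriv]
        rfl
      simp only [h1]
      exact (continuousMultilinearCurryLeftEquiv ℝ
        (fun _ : Fin (m + 1) => E) ℝ).toContinuousLinearEquiv.map_tsum
    refine ⟨fun x hx => ?_, fun m _ x hx => (hder m x hx).hasFDerivWithinAt, fun m _ x hx =>
      (hder m x hx).continuousAt.continuousWithinAt⟩
    have := (continuousMultilinearCurryFin0 ℝ E ℝ).toContinuousLinearEquiv.map_tsum
      (f := fun k => iteratedFDeriv ℝ 0 (h k) x) (L := .unconditional ℕ)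
    refine this.trans ?_
    simp
  refine ⟨hT.contDiffOn, fun j y hy => ?_⟩
  rw [← iteratedFDerivWithin_of_isOpen j Metric.isOpen_ball hy,
    ← hT.eq_iteratedFDerivWithin_of_uniqueDiffOn (m := j) (by exact_mod_cast le_top)
      Metric.isOpen_ball.uniqueDiffOn hy]
  exact (hsum j y hy).hasSum

end

/-- `b k s` decays faster than every power of `2⁻ᵏ`, uniformly in the parameters `s` with
`D k s`. -/
def RapidDecay {J : Type*} (D : ℕ → J → Prop) (b : ℕ → J → ℝ) : Prop :=
  ∀ N : ℕ, ∀ᶠ k in atTop, ∀ s, D k s → b k s ≤ ((1 / 2 : ℝ) ^ k) ^ N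

lemma eventually_mul_half_pow_le (C : ℝ) (A N : ℕ) :
    ∀ᶠ k : ℕ in atTop,
      C * ((2 : ℝ) ^ k) ^ A * ((1 / 2 : ℝ) ^ k) ^ (N + A + 1) ≤ ((1 / 2 : ℝ) ^ k) ^ N := by
  have h : Tendsto (fun k : ℕ => C * (1 / 2 : ℝ) ^ k) atTop (𝓝 (C * 0)) :=
    (tendsto_pow_atTop_nhds_zero_of_lt_one (by norm_num) (by norm_num)).const_mul C
  rw [mul_zero] at h
  filter_upwards [h.eventually_le_const one_pos] with k hk
  have h1 : ((2 : ℝ) ^ k) ^ A * ((1 / 2 : ℝ) ^ k) ^ A = 1 := by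
    rw [← mul_pow, ← mul_pow]; norm_num
  calc _ = (C * (1 / 2 : ℝ) ^ k) * (((2 : ℝ) ^ k) ^ A * ((1 / 2 : ℝ) ^ k) ^ A)
        * ((1 / 2 : ℝ) ^ k) ^ N := by ring
    _ ≤ 1 * 1 * ((1 / 2 : ℝ) ^ k) ^ N := by rw [h1]; gcongr
    _ = _ := by ring

namespace RapidDecay
variable {J : Type*} {D : ℕ → J → Prop}

lemma of_le_mul {b b' : ℕ → J → ℝ} (hb : RapidDecay D b) (C : ℝ) (A : ℕ) (hC : 0 ≤ C)
    (h : ∀ᶠ k in atTop, ∀ s, D k s → b' k s ≤ C * ((2 : ℝ) ^ k) ^ A * b k s) :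
    RapidDecay D b' := by
  intro N
  filter_upwards [hb (N + A + 1), h, eventually_mul_half_pow_le C A N] with k h1 h2 h3 s hs
  exact (h2 s hs).trans ((mul_le_mul_of_nonneg_left (h1 s hs) (by positivity)).trans h3)

lemma mul_tempered {b t : ℕ → J → ℝ} (hb : RapidDecay D b) (hb0 : ∀ k s, 0 ≤ b k s) {C : ℝ} {A : ℕ}
    (hC : 0 ≤ C) (ht : ∀ k s, t k s ≤ C * ((2 : ℝ) ^ k) ^ A) :
    RapidDecay D (fun k s => t k s * b k s) :=
  hb.of_le_mul C A hC <| .of_forall fun k s _ =>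
    mul_le_mul_of_nonneg_right (ht k s) (hb0 k s)

lemma zero : RapidDecay D (fun _ _ => 0) := fun N => .of_forall fun k _ _ => by positivity

lemma add {b b' : ℕ → J → ℝ} (hb : RapidDecay D b) (hb' : RapidDecay D b') :
    RapidDecay D (fun k s => b k s + b' k s) := by
  intro N
  filter_upwards [hb (N + 1), hb' (N + 1), eventually_mul_half_pow_le 2 0 N] with k h1 h2 h3 s hs
  have := h1 s hs
  have := h2 s hs
  simp only [pow_zero, mul_one, add_zero] at h3
  linarith

lemma sum {ι : Type*} {b : ι → ℕ → J → ℝ} {S : Finset ι} (hb : ∀ i ∈ S, RapidDecay D (b i)) :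
    RapidDecay D (fun k s => ∑ i ∈ S, b i k s) := by
  classical
  induction S using Finset.induction_on with
  | empty => simpa using zero
  | insert i S hi ih =>
    simp only [Finset.sum_insert hi]
    exact (hb i (Finset.mem_insert_self _ _)).add
      (ih fun l hl => hb l (Finset.mem_insert_of_mem hl))

end RapidDecay

section
variable {E : Type*} [NormedAddCommGroup E] [NormedSpace ℝ E]

/-- Multiplication by functions with tempered derivatives preserves rapid decay, and allows the
domain to be enlarged outside of the supports of the factors. -/
lemma RapidDecay.mul_smooth {J : Type*} {D D' : ℕ → J → Prop} {w Q : ℕ → J → E → ℝ}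
    {y : ℕ → J → E} (hw : ∀ k s, ContDiff ℝ (⊤ : ℕ∞) (w k s))
    (hQ : ∀ k s, ContDiff ℝ (⊤ : ℕ∞) (Q k s))
    (hwt : ∀ j : ℕ, ∃ C ≥ (0 : ℝ), ∃ A : ℕ, ∀ k s x,
      ‖iteratedFDeriv ℝ j (w k s) x‖ ≤ C * ((2 : ℝ) ^ k) ^ A)
    (hr : ∀ j : ℕ, RapidDecay D (fun k s => ‖iteratedFDeriv ℝ j (Q k s) (y k s)‖))
    (hD : ∀ k s, D' k s → y k s ∈ tsupport (w k s) → D k s) (j : ℕ) :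
    RapidDecay D' (fun k s => ‖iteratedFDeriv ℝ j (fun x => w k s x * Q k s x) (y k s)‖) := by
  have h1 : RapidDecay D (fun k s => ∑ i ∈ Finset.range (j + 1),
      ((j.choose i : ℝ) * ‖iteratedFDeriv ℝ i (w k s) (y k s)‖) *
        ‖iteratedFDeriv ℝ (j - i) (Q k s) (y k s)‖) := by
    refine RapidDecay.sum fun i _ => ?_
    obtain ⟨C, hC, A, h⟩ := hwt i
    refine (hr (j - i)).mul_tempered (fun _ _ => norm_nonneg _) (C := j.choose i * C) (A := A)
      (by positivity) fun k s => ?_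
    rw [mul_assoc]
    exact mul_le_mul_of_nonneg_left (h k s _) (by positivity)
  intro N
  filter_upwards [h1 N] with k hk s hs
  by_cases hy : y k s ∈ tsupport (w k s)
  · exact (norm_iteratedFDeriv_mul_le (hw k s) (hQ k s) _ (by exact_mod_cast le_top)).trans
      (hk s (hD k s hs hy))
  · have h0 : (fun x => w k s x * Q k s x) =ᶠ[𝓝 (y k s)] fun _ => 0 := by
      filter_upwards [notMem_tsupport_iff_eventuallyEq.1 hy] with x hx
      simp [hx]
    rw [(h0.iteratedFDeriv ℝ j).eq_of_nhds]
    simp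
end

lemma norm_le_of_coord_le {n : ℕ} {v : EuclideanSpace ℝ (Fin n)} {a : ℝ} (h : ∀ i, |v i| ≤ a) :
    ‖v‖ ≤ n * a := by
  have hv : v = ∑ i, v i • EuclideanSpace.single i (1 : ℝ) := by
    ext i
    simp [Finset.sum_apply, Pi.single_apply]
  rw [hv]
  refine (norm_sum_le _ _).trans ((Finset.sum_le_card_nsmul _ _ a fun i _ => ?_).trans ?_)
  · simpa [norm_smul] using h i
  · simp

/-- A smooth function supported in `[-1, 1]` whose integer translates sum to one. -/
def unitBump (t : ℝ) : ℝ := Real.smoothTransition (t + 1) - Real.smoothTransition t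

lemma contDiff_unitBump : ContDiff ℝ (⊤ : ℕ∞) unitBump :=
  (Real.smoothTransition.contDiff.comp (contDiff_id.add contDiff_const)).sub
    Real.smoothTransition.contDiff

lemma abs_le_one_of_unitBump_ne_zero {t : ℝ} (h : unitBump t ≠ 0) : |t| ≤ 1 := by
  by_contra! ht
  apply h
  unfold unitBump
  rcases lt_abs.1 ht with ht | ht
  · rw [Real.smoothTransition.one_of_one_le (by linarith),
      Real.smoothTransition.one_of_one_le (by linarith), sub_self]
  · rw [Real.smoothTransition.zero_of_nonpos (by linarith),
      Real.smoothTransition.zero_of_nonpos (by linarith), sub_self]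

lemma sum_Icc_unitBump (t : ℝ) (a : ℤ) (m : ℕ) :
    ∑ b ∈ Finset.Icc a (a + m), unitBump (t - b)
      = Real.smoothTransition (t - a + 1) - Real.smoothTransition (t - a - m) := by
  induction m with
  | zero => simp [unitBump]
  | succ m ih =>
    have h := Finset.insert_Icc_right_eq_Icc_add_one (a := a) (b := a + m) (by omega)
    have hc : a + ((m + 1 : ℕ) : ℤ) = a + m + 1 := by push_cast; ring
    rw [hc, ← h, Finset.sum_insert (by simp), ih, unitBump]
    push_cast
    rw [show t - (a + m + 1) + 1 = t - a - (m : ℝ) by ring,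
      show t - (a + m + 1) = t - a - ((m : ℝ) + 1) by ring]
    ring

lemma sum_Icc_unitBump_eq_one {t : ℝ} {B : ℕ} (h : |t| ≤ B) :
    ∑ b ∈ Finset.Icc (-B : ℤ) B, unitBump (t - b) = 1 := by
  have := sum_Icc_unitBump t (-B) (2 * B)
  rw [show (-(B : ℤ) + ((2 * B : ℕ) : ℤ)) = B by push_cast; ring] at this
  rw [this]
  obtain ⟨h1, h2⟩ := abs_le.1 h
  rw [Real.smoothTransition.one_of_one_le (by push_cast; linarith),
    Real.smoothTransition.zero_of_nonpos (by push_cast; linarith), sub_zero]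

/-- The partition of unity function of scale `2⁻ᵏ` centred at the lattice point `2⁻ᵏ z`. -/
def latticeBump {n : ℕ} (k : ℕ) (z : Fin n → ℤ) (y : EuclideanSpace ℝ (Fin n)) : ℝ :=
  ∏ i, unitBump (2 ^ k * y i - z i)

/-- The lattice points that are relevant for `latticeBump` at scale `2⁻ᵏ` on the ball of
radius `R`. -/
def latticeBox (n k R : ℕ) : Finset (Fin n → ℤ) :=
  Fintype.piFinset fun _ => Finset.Icc (-((2 ^ k * R + 1 : ℕ) : ℤ)) ((2 ^ k * R + 1 : ℕ) : ℤ)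

lemma contDiff_latticeBump {n : ℕ} (k : ℕ) (z : Fin n → ℤ) :
    ContDiff ℝ (⊤ : ℕ∞) (latticeBump k z) := by
  unfold latticeBump
  refine contDiff_prod fun i _ => contDiff_unitBump.comp ?_
  fun_prop

lemma abs_sub_le_of_latticeBump_ne_zero {n k : ℕ} {z : Fin n → ℤ} {y : EuclideanSpace ℝ (Fin n)}
    (h : latticeBump k z y ≠ 0) (i : Fin n) : |2 ^ k * y i - z i| ≤ 1 :=
  abs_le_one_of_unitBump_ne_zero (Finset.prod_ne_zero_iff.1 h i (Finset.mem_univ i))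

lemma abs_sub_le_of_mem_tsupport {n k : ℕ} {z : Fin n → ℤ} {y : EuclideanSpace ℝ (Fin n)}
    (h : y ∈ tsupport (latticeBump k z)) (i : Fin n) : |2 ^ k * y i - z i| ≤ 1 := by
  have hc : IsClosed {y : EuclideanSpace ℝ (Fin n) | |2 ^ k * y i - z i| ≤ 1} :=
    isClosed_le (by fun_prop) continuous_const
  exact closure_minimal (fun y hy => abs_sub_le_of_latticeBump_ne_zero hy i) hc h

lemma abs_mul_coord_le {n k R : ℕ} {y : EuclideanSpace ℝ (Fin n)} (hy : ‖y‖ ≤ R) (i : Fin n) :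
    |2 ^ k * y i| ≤ 2 ^ k * R := by
  rw [abs_mul, abs_of_pos (by positivity : (0 : ℝ) < 2 ^ k)]
  gcongr
  exact (PiLp.norm_apply_le y i).trans hy

lemma mem_latticeBox {n k R : ℕ} {z : Fin n → ℤ} {y : EuclideanSpace ℝ (Fin n)}
    (hy : ‖y‖ ≤ R) (h : latticeBump k z y ≠ 0) : z ∈ latticeBox n k R := by
  refine Fintype.mem_piFinset.2 fun i => Finset.mem_Icc.2 ?_
  have h1 := abs_le.1 (abs_sub_le_of_latticeBump_ne_zero h i)
  have h2 := abs_le.1 (abs_mul_coord_le (k := k) hy i)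
  constructor
  · have : (-((2 ^ k * R + 1 : ℕ) : ℝ)) ≤ z i := by push_cast; linarith
    exact_mod_cast this
  · have : (z i : ℝ) ≤ ((2 ^ k * R + 1 : ℕ) : ℝ) := by push_cast; linarith
    exact_mod_cast this

lemma sum_latticeBump {n k R : ℕ} {y : EuclideanSpace ℝ (Fin n)} (hy : ‖y‖ ≤ R) :
    ∑ z ∈ latticeBox n k R, latticeBump k z y = 1 := by
  unfold latticeBump latticeBox
  rw [← Finset.prod_univ_sum (fun _ : Fin n => Finset.Icc (-((2 ^ k * R + 1 : ℕ) : ℤ)) _)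
    (fun i (b : ℤ) => unitBump (2 ^ k * y i - b))]
  refine Finset.prod_eq_one fun i _ => sum_Icc_unitBump_eq_one ?_
  have := abs_mul_coord_le (k := k) hy i
  push_cast
  linarith

lemma card_latticeBox_le (n k R : ℕ) :
    ((latticeBox n k R).card : ℝ) ≤ (2 * R + 3) ^ n * ((2 : ℝ) ^ k) ^ n := by
  have h1 : (latticeBox n k R).card = (2 * (2 ^ k * R + 1) + 1) ^ n := by
    rw [latticeBox, Fintype.card_piFinset, Finset.prod_const, Int.card_Icc]
    simp only [Finset.card_univ, Fintype.card_fin]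
    congr 1
    omega
  rw [h1, ← mul_pow]
  push_cast
  have : (1 : ℝ) ≤ 2 ^ k := one_le_pow₀ (by norm_num)
  gcongr
  nlinarith

lemma exists_bound_iteratedFDeriv_latticeBump (n j : ℕ) : ∃ C ≥ (0 : ℝ), ∃ A : ℕ,
    ∀ (k : ℕ) (z : Fin n → ℤ) (x : EuclideanSpace ℝ (Fin n)),
      ‖iteratedFDeriv ℝ j (latticeBump k z) x‖ ≤ C * ((2 : ℝ) ^ k) ^ A := by
  set g : EuclideanSpace ℝ (Fin n) → ℝ := latticeBump 0 0 with hg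
  have hgs : ContDiff ℝ (⊤ : ℕ∞) g := contDiff_latticeBump 0 0
  have hc : HasCompactSupport g := by
    refine HasCompactSupport.intro (isCompact_closedBall 0 (n : ℝ)) fun x hx => ?_
    by_contra h
    refine hx (mem_closedBall_zero_iff.2 ?_)
    simpa using norm_le_of_coord_le (v := x) (a := 1) fun i => by
      simpa using abs_sub_le_of_latticeBump_ne_zero h i
  obtain ⟨C, hC⟩ := (hc.iteratedFDeriv (𝕜 := ℝ) j).exists_bound_of_continuous
    (hgs.continuous_iteratedFDeriv (m := j) (natCast_lt_infty j).le)
  refine ⟨C, (norm_nonneg _).trans (hC 0), j, fun k z x => ?_⟩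
  have he : latticeBump k z = fun y : EuclideanSpace ℝ (Fin n) =>
      (fun v => g (v - WithLp.toLp 2 fun i => (z i : ℝ))) ((2 : ℝ) ^ k • y) := by
    funext y
    simp [hg, latticeBump]
  have hs : ContDiff ℝ j fun v => g (v - WithLp.toLp 2 fun i => (z i : ℝ)) :=
    (hgs.comp (contDiff_id.sub contDiff_const)).of_le (natCast_lt_infty j).le
  rw [he, iteratedFDeriv_comp_const_smul _ hs, norm_smul, norm_pow, iteratedFDeriv_comp_sub,
    mul_comm, Real.norm_of_nonneg (by positivity)]
  gcongr
  exact hC _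

/-- The coefficients of the jet at `x`, with those exceeding `2ᵏ` discarded. -/
def truncCoeff {n : ℕ} (F : (Fin n → ℕ) → EuclideanSpace ℝ (Fin n) → ℝ) (k : ℕ)
    (x : EuclideanSpace ℝ (Fin n)) (α : Fin n → ℕ) : ℝ :=
  if |F α x| ≤ 2 ^ k then F α x else 0

/-- The truncated Taylor polynomial at `x` used at scale `2⁻ᵏ`. -/
def stagePoly {n : ℕ} (F : (Fin n → ℕ) → EuclideanSpace ℝ (Fin n) → ℝ) (k : ℕ)
    (x y : EuclideanSpace ℝ (Fin n)) : ℝ :=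
  taylorPoly k (truncCoeff F k x) (y - x)

lemma contDiff_stagePoly {n : ℕ} (F : (Fin n → ℕ) → EuclideanSpace ℝ (Fin n) → ℝ) (k : ℕ)
    (x : EuclideanSpace ℝ (Fin n)) : ContDiff ℝ (⊤ : ℕ∞) (stagePoly F k x) :=
  contDiff_taylorPoly _ _ _

lemma abs_truncCoeff_le {n : ℕ} (F : (Fin n → ℕ) → EuclideanSpace ℝ (Fin n) → ℝ) (k : ℕ)
    (x : EuclideanSpace ℝ (Fin n)) (α : Fin n → ℕ) : |truncCoeff F k x α| ≤ 2 ^ k := by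
  unfold truncCoeff
  split_ifs with h
  · exact h
  · simp

lemma eventually_truncCoeff_eq {n : ℕ} {F : (Fin n → ℕ) → EuclideanSpace ℝ (Fin n) → ℝ}
    {K : Set (EuclideanSpace ℝ (Fin n))} (hK : IsCompact K) (hF : ∀ α, ContinuousOn (F α) K)
    (M : ℕ) : ∀ᶠ k in atTop, ∀ α, ∑ i, α i ≤ M → ∀ x ∈ K, truncCoeff F k x α = F α x := by
  have h : ∀ᶠ k in atTop, ∀ α ∈ multiIdx n M, ∀ x ∈ K, truncCoeff F k x α = F α x := by
    rw [Filter.eventually_all_finset]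
    intro α _
    obtain ⟨C, hC⟩ := hK.exists_bound_of_continuousOn (hF α)
    filter_upwards [(tendsto_pow_atTop_atTop_of_one_lt (one_lt_two (α := ℝ))).eventually_ge_atTop C]
      with k hk x hx
    exact if_pos ((hC x hx).trans hk)
  simpa only [mem_multiIdx] using h

lemma eventually_mul_half_pow_le_const (c : ℝ) {δ : ℝ} (hδ : 0 < δ) :
    ∀ᶠ k : ℕ in atTop, c * (1 / 2 : ℝ) ^ k ≤ δ := by
  have h : Tendsto (fun k : ℕ => c * (1 / 2 : ℝ) ^ k) atTop (𝓝 (c * 0)) :=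
    (tendsto_pow_atTop_nhds_zero_of_lt_one (by norm_num) (by norm_num)).const_mul c
  rw [mul_zero] at h
  exact h.eventually_le_const hδ

section
variable {n : ℕ} {F : (Fin n → ℕ) → EuclideanSpace ℝ (Fin n) → ℝ}
  {K : Set (EuclideanSpace ℝ (Fin n))}

lemma iteratedFDeriv_sub_taylorPoly (k m m' : ℕ) (c c' : (Fin n → ℕ) → ℝ)
    (x x' y : EuclideanSpace ℝ (Fin n)) (j : Fin k → Fin n) :
    iteratedFDeriv ℝ k (fun y => taylorPoly m c (y - x) - taylorPoly m' c' (y - x')) y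
        (fun l => EuclideanSpace.single (j l) 1)
      = (if k ≤ m then taylorPoly (m - k) (fun α => c (α + countIdx j)) (y - x) else 0)
        - if k ≤ m' then taylorPoly (m' - k) (fun α => c' (α + countIdx j)) (y - x') else 0 := by
  rw [fun_iteratedFDeriv_sub_apply
      ((contDiff_taylorPoly m c x).of_le (natCast_lt_infty k).le).contDiffAt
      ((contDiff_taylorPoly m' c' x').of_le (natCast_lt_infty k).le).contDiffAt,
    sub_apply, iteratedFDeriv_taylorPoly, iteratedFDeriv_taylorPoly]

lemma eventually_stagePoly_sub_taylorPoly_le (hK : IsCompact K)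
    (hF : ∀ α, ContinuousOn (F α) K) {c : ℝ} (hc : 0 ≤ c) (j N : ℕ) :
    ∀ᶠ k in atTop, ∀ x ∈ K, ∀ y, dist y x ≤ c * (1 / 2 : ℝ) ^ k →
      ‖iteratedFDeriv ℝ j (fun y => stagePoly F k x y
        - taylorPoly (j + N + n + 1) (fun α => F α x) (y - x)) y‖ ≤ ((1 / 2 : ℝ) ^ k) ^ N := by
  set M := j + N + n + 1 with hM
  filter_upwards [eventually_truncCoeff_eq hK hF M, eventually_ge_atTop M,
    eventually_mul_half_pow_le_const c one_pos,
    eventually_mul_half_pow_le (2 ^ (N + n + 2) * n ^ (M + 1) * c ^ (N + n + 2)) (n + 1) N]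
    with k h1 h2 h3 h4 x hx y hy
  have hA : ((k : ℝ) + 1) ^ n * 2 ^ k ≤ ((2 : ℝ) ^ k) ^ (n + 1) := by
    rw [pow_succ]
    gcongr
    exact_mod_cast Nat.lt_two_pow_self (n := k)
  have key := norm_iteratedFDeriv_le_of_center
    (g := fun y => stagePoly F k x y - taylorPoly M (fun α => F α x) (y - x))
    ((contDiff_stagePoly F k x).sub (contDiff_taylorPoly _ _ _)) (x := x)
    (r := c * (1 / 2 : ℝ) ^ k) (A := n ^ (M + 1) * ((2 : ℝ) ^ k) ^ (n + 1)) (L := M + 1)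
    (by positivity) (by positivity) ?_ ?_ (d := N + n + 2) (by omega) hy
  · rw [show M + 1 - (N + n + 2) = j by omega] at key
    refine key.trans (le_trans (le_of_eq ?_) h4)
    rw [mul_pow c, show N + (n + 1) + 1 = N + n + 2 by ring]
    ring
  · intro i hi
    refine (norm_le_sum_single _ (A := 0) (fun l => ?_) le_rfl).trans (by simp; positivity)
    rw [show stagePoly F k x = fun y => taylorPoly k (truncCoeff F k x) (y - x) from rfl,
      iteratedFDeriv_sub_taylorPoly, if_pos (by omega), if_pos (by omega), sub_self,
      taylorPoly_zero, taylorPoly_zero, h1 _ (by simp [sum_countIdx]; omega) x hx]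
    simp
  · intro z hz
    refine norm_le_sum_single _ (fun l => ?_) (by positivity)
    rw [show stagePoly F k x = fun y => taylorPoly k (truncCoeff F k x) (y - x) from rfl,
      iteratedFDeriv_sub_taylorPoly, if_neg (show ¬ (M + 1 ≤ M) by omega), sub_zero]
    split_ifs with hk
    · refine (abs_taylorPoly_le _ _ _ ?_ (A := 2 ^ k) (by positivity)
        fun α => abs_truncCoeff_le _ _ _ _).trans (le_trans ?_ hA)
      · rw [← dist_eq_norm]; exact hz.trans h3
      · gcongr
        omega
    · simp

lemma eventually_taylorPoly_sub_taylorPoly_le (M : ℕ)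
    (hF : ∀ β : Fin n → ℕ, (∑ i, β i) ≤ M →
      ∀ ε > (0:ℝ), ∃ δ > (0:ℝ), ∀ x ∈ K, ∀ y ∈ K, 0 < dist x y → dist x y ≤ δ →
      |taylorRem M F β x y| ≤ ε * dist x y ^ (M - ∑ i, β i))
    {c : ℝ} (hc : 0 < c) (j N : ℕ) (hM : M = j + N + n + 1) :
    ∀ᶠ k in atTop, ∀ x ∈ K, ∀ x' ∈ K, ∀ y, dist y x ≤ c * (1 / 2 : ℝ) ^ k →
      dist y x' ≤ c * (1 / 2 : ℝ) ^ k →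
      ‖iteratedFDeriv ℝ j (fun y => taylorPoly M (fun α => F α x) (y - x)
        - taylorPoly M (fun α => F α x') (y - x')) y‖ ≤ ((1 / 2 : ℝ) ^ k) ^ N := by
  have hδ : ∀ᶠ k : ℕ in atTop, ∀ β ∈ multiIdx n M, ∀ x ∈ K, ∀ y ∈ K, 0 < dist x y →
      dist x y ≤ 2 * c * (1 / 2 : ℝ) ^ k → |taylorRem M F β x y| ≤ dist x y ^ (M - ∑ i, β i) := by
    rw [Filter.eventually_all_finset]
    intro β hβ
    obtain ⟨δ, hδ, h⟩ := hF β (mem_multiIdx.1 hβ) 1 one_pos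
    filter_upwards [eventually_mul_half_pow_le_const (2 * c) hδ] with k hk x hx y hy h0 h1
    simpa using h x hx y hy h0 (h1.trans hk)
  filter_upwards [hδ,
    eventually_mul_half_pow_le (2 ^ (N + n + 2) * (n + 1) ^ M * (2 * c) ^ (N + n + 1)) n N]
    with k h1 h2 x hx x' hx' y hy hy'
  rcases eq_or_ne x x' with rfl | hne
  · simp
  set R := 2 * c * (1 / 2 : ℝ) ^ k with hR
  have hR0 : 0 < R := by positivity
  have hxx : dist x x' ≤ R := by
    have := dist_triangle_left x x' y
    linarith
  have hA : ∀ i, i ≤ M → (n + 1 : ℝ) ^ M / R * R ^ (M + 1 - i) = (n + 1 : ℝ) ^ M * R ^ (M - i) := by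
    intro i hi
    rw [show M + 1 - i = (M - i) + 1 by omega, pow_succ]
    field_simp
  have key := norm_iteratedFDeriv_le_of_center
    (g := fun y => taylorPoly M (fun α => F α x) (y - x) - taylorPoly M (fun α => F α x') (y - x'))
    ((contDiff_taylorPoly _ _ _).sub (contDiff_taylorPoly _ _ _)) (x := x') (y := y)
    (r := R) (A := (n + 1 : ℝ) ^ M / R) (L := M + 1)
    hR0.le (by positivity) ?_ ?_ (d := N + n + 2) (by omega)
    (hy'.trans (by
      have : 0 < c * (1 / 2 : ℝ) ^ k := by positivity
      linarith))
  · rw [show M + 1 - (N + n + 2) = j by omega] at key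
    refine key.trans (le_trans ?_ h2)
    have := hA j (by omega)
    rw [show M + 1 - j = N + n + 2 by omega, show M - j = N + n + 1 by omega] at this
    rw [mul_assoc, this, hR, mul_pow (2 * c)]
    have h3 : (1 : ℝ) ≤ ((2 : ℝ) ^ k) ^ n := one_le_pow₀ (one_le_pow₀ one_le_two)
    calc _ = (2 : ℝ) ^ (N + n + 2) * (n + 1) ^ M * (2 * c) ^ (N + n + 1) * 1
          * ((1 / 2 : ℝ) ^ k) ^ (N + n + 1) := by ring
      _ ≤ _ := by gcongr
  · intro i hi
    rw [hA i (by omega)]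
    refine (norm_le_sum_single _ (A := R ^ (M - i)) (fun l => ?_) (by positivity)).trans ?_
    · rw [iteratedFDeriv_sub_taylorPoly, if_pos (by omega), if_pos (by omega), sub_self,
        taylorPoly_zero, zero_add]
      have h3 := h1 (countIdx l) (mem_multiIdx.2 (by rw [sum_countIdx]; omega)) x hx x' hx'
        (dist_pos.2 hne) hxx
      rw [taylorRem_eq, sum_countIdx, abs_sub_comm] at h3
      exact h3.trans (by gcongr)
    · gcongr
      calc (n : ℝ) ^ i ≤ (n + 1 : ℝ) ^ i := by gcongr; linarith
        _ ≤ (n + 1 : ℝ) ^ M := by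
          gcongr
          · linarith [(Nat.cast_nonneg n : (0 : ℝ) ≤ n)]
          · omega
  · intro z hz
    refine (norm_le_sum_single _ (A := 0) (fun l => ?_) le_rfl).trans (by simp; positivity)
    rw [iteratedFDeriv_sub_taylorPoly, if_neg (by omega), if_neg (by omega)]
    simp

/-- The polynomials attached to nearby points of `K` agree to infinite order in the scale. -/
lemma rapidDecay_stagePoly_sub (hK : IsCompact K) (hF : ∀ α, ContinuousOn (F α) K)
    (hW : ∀ M : ℕ, ∀ β : Fin n → ℕ, (∑ i, β i) ≤ M →
      ∀ ε > (0:ℝ), ∃ δ > (0:ℝ), ∀ x ∈ K, ∀ y ∈ K, 0 < dist x y → dist x y ≤ δ →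
      |taylorRem M F β x y| ≤ ε * dist x y ^ (M - ∑ i, β i))
    {c : ℝ} (hc : 0 < c) {σ : ℕ → ℕ} (hσ : ∀ k, k ≤ σ k) (j : ℕ) :
    RapidDecay (J := EuclideanSpace ℝ (Fin n) × EuclideanSpace ℝ (Fin n) ×
        EuclideanSpace ℝ (Fin n))
      (fun k s => s.1 ∈ K ∧ s.2.1 ∈ K ∧ dist s.2.2 s.1 ≤ c * (1 / 2 : ℝ) ^ k ∧
        dist s.2.2 s.2.1 ≤ c * (1 / 2 : ℝ) ^ (σ k))
      (fun k s => ‖iteratedFDeriv ℝ j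
        (fun y => stagePoly F (σ k) s.2.1 y - stagePoly F k s.1 y) s.2.2‖) := by
  intro N
  have hA := eventually_stagePoly_sub_taylorPoly_le hK hF hc.le j (N + 1)
  filter_upwards [hA, (tendsto_atTop_mono hσ tendsto_id).eventually hA,
    eventually_taylorPoly_sub_taylorPoly_le _ (hW (j + (N + 1) + n + 1)) hc j (N + 1) rfl,
    eventually_mul_half_pow_le 3 0 N] with k h1 h2 h3 h4
  rintro ⟨x, x', y⟩ ⟨hx, hx', hy, hy'⟩
  dsimp only at hx hx' hy hy' ⊢
  have hσk : (1 / 2 : ℝ) ^ (σ k) ≤ (1 / 2 : ℝ) ^ k :=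
    pow_le_pow_of_le_one (by norm_num) (by norm_num) (hσ k)
  have e1 := h1 x hx y hy
  have e2 := (h2 x' hx' y hy').trans (pow_le_pow_left₀ (by positivity) hσk (N + 1))
  have e3 := h3 x hx x' hx' y hy (hy'.trans (by gcongr))
  set M := j + (N + 1) + n + 1
  set a := fun y => stagePoly F k x y - taylorPoly M (fun α => F α x) (y - x)
  set b := fun y => stagePoly F (σ k) x' y - taylorPoly M (fun α => F α x') (y - x')
  set d := fun y => taylorPoly M (fun α => F α x) (y - x) - taylorPoly M (fun α => F α x') (y - x')
  have ha : ContDiff ℝ j a := ((contDiff_stagePoly F k x).sub (contDiff_taylorPoly _ _ _)).of_le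
    (natCast_lt_infty j).le
  have hb : ContDiff ℝ j b := ((contDiff_stagePoly F (σ k) x').sub
    (contDiff_taylorPoly _ _ _)).of_le (natCast_lt_infty j).le
  have hd : ContDiff ℝ j d := ((contDiff_taylorPoly _ _ _).sub
    (contDiff_taylorPoly _ _ _)).of_le (natCast_lt_infty j).le
  have he : (fun y => stagePoly F (σ k) x' y - stagePoly F k x y) = fun y => b y - (a y + d y) := by
    funext y
    simp only [a, b, d]
    ring
  rw [he, fun_iteratedFDeriv_sub_apply hb.contDiffAt (ha.add hd).contDiffAt,
    fun_iteratedFDeriv_add_apply ha.contDiffAt hd.contDiffAt]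
  have t1 := norm_sub_le (iteratedFDeriv ℝ j b y) (iteratedFDeriv ℝ j a y + iteratedFDeriv ℝ j d y)
  have t2 := norm_add_le (iteratedFDeriv ℝ j a y) (iteratedFDeriv ℝ j d y)
  simp only [pow_zero, mul_one, add_zero] at h4
  linarith
end

lemma RapidDecay.sum_smooth {E : Type*} [NormedAddCommGroup E] [NormedSpace ℝ E] {J ι : Type*}
    {D : ℕ → J → Prop} {φ : ℕ → ι → J → E → ℝ} {y : ℕ → J → E} {S : ℕ → Finset ι} {C : ℝ} {A : ℕ}
    (hS : ∀ k, ((S k).card : ℝ) ≤ C * ((2 : ℝ) ^ k) ^ A)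
    (hφ : ∀ k i s, ContDiff ℝ (⊤ : ℕ∞) (φ k i s)) (j : ℕ)
    (hr : RapidDecay (J := ι × J) (fun k s => D k s.2)
      (fun k s => ‖iteratedFDeriv ℝ j (φ k s.1 s.2) (y k s.2)‖)) :
    RapidDecay D (fun k s => ‖iteratedFDeriv ℝ j (fun x => ∑ i ∈ S k, φ k i s x) (y k s)‖) := by
  intro N
  filter_upwards [hr (N + A + 1), eventually_mul_half_pow_le C A N] with k h1 h2 s hs
  rw [iteratedFDeriv_fun_sum_apply
    fun i _ => ((hφ k i s).of_le (natCast_lt_infty j).le).contDiffAt]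
  calc _ ≤ ∑ i ∈ S k, ((1 / 2 : ℝ) ^ k) ^ (N + A + 1) :=
        norm_sum_le_of_le _ fun i _ => h1 (i, s) hs
    _ = ((S k).card : ℝ) * ((1 / 2 : ℝ) ^ k) ^ (N + A + 1) := by simp
    _ ≤ C * ((2 : ℝ) ^ k) ^ A * ((1 / 2 : ℝ) ^ k) ^ (N + A + 1) := by gcongr; exact hS k
    _ ≤ _ := h2

section
variable {n : ℕ} (X : Set (EuclideanSpace ℝ (Fin n)))
  (F : (Fin n → ℕ) → EuclideanSpace ℝ (Fin n) → ℝ)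

/-- The lattice point `2⁻ᵏ z` is close to the set `X` at scale `2⁻ᵏ`. -/
def IsNear (k : ℕ) (z : Fin n → ℤ) : Prop :=
  ∃ x ∈ X, ∀ i, |2 ^ k * x i - z i| ≤ 2

open Classical in
/-- A point of `X` close to the lattice point `2⁻ᵏ z`, if there is one. -/
def nearPt (k : ℕ) (z : Fin n → ℤ) : EuclideanSpace ℝ (Fin n) :=
  if h : IsNear X k z then h.choose else 0

open Classical in
/-- The lattice bump at `2⁻ᵏ z`, discarded if the lattice point is far from `X`. -/
def nearBump (k : ℕ) (z : Fin n → ℤ) (y : EuclideanSpace ℝ (Fin n)) : ℝ :=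
  if IsNear X k z then latticeBump k z y else 0

/-- The sum of the bumps at scale `2⁻ᵏ` which are close to `X`. -/
def cutoff (k : ℕ) (y : EuclideanSpace ℝ (Fin n)) : ℝ :=
  ∑ᶠ z, nearBump X k z y

/-- The approximate extension at scale `2⁻ᵏ`. -/
def stageFun (k : ℕ) (y : EuclideanSpace ℝ (Fin n)) : ℝ :=
  ∑ᶠ z, nearBump X k z y * stagePoly F k (nearPt X k z) y

/-- The correction leading from scale `2⁻ᵏ` to scale `2⁻ᵏ⁻¹`, cut off near `X`. -/
def stageStep (k : ℕ) (y : EuclideanSpace ℝ (Fin n)) : ℝ :=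
  cutoff X k y * stageFun X F (k + 1) y - cutoff X (k + 1) y * stageFun X F k y

/-- The extension of the jet `F`. -/
def jetExtension (y : EuclideanSpace ℝ (Fin n)) : ℝ :=
  stageFun X F 0 y + ∑' k, stageStep X F k y

variable {X F}

lemma contDiff_nearBump (k : ℕ) (z : Fin n → ℤ) : ContDiff ℝ (⊤ : ℕ∞) (nearBump X k z) := by
  unfold nearBump
  split_ifs
  · exact contDiff_latticeBump k z
  · exact contDiff_const

lemma latticeBump_ne_zero_of_nearBump {k : ℕ} {z : Fin n → ℤ} {y : EuclideanSpace ℝ (Fin n)}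
    (h : nearBump X k z y ≠ 0) : latticeBump k z y ≠ 0 := by
  unfold nearBump at h
  split_ifs at h with h'
  · exact h
  · exact absurd rfl h

lemma exists_bound_iteratedFDeriv_nearBump (X : Set (EuclideanSpace ℝ (Fin n))) (j : ℕ) :
    ∃ C ≥ (0 : ℝ), ∃ A : ℕ, ∀ k z x,
      ‖iteratedFDeriv ℝ j (nearBump X k z) x‖ ≤ C * ((2 : ℝ) ^ k) ^ A := by
  obtain ⟨C, hC, A, h⟩ := exists_bound_iteratedFDeriv_latticeBump n j
  refine ⟨C, hC, A, fun k z x => ?_⟩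
  by_cases hz : IsNear X k z
  · rw [show nearBump X k z = latticeBump k z from funext fun y => if_pos hz]
    exact h k z x
  · rw [show nearBump X k z = fun _ => 0 from funext fun y => if_neg hz, iteratedFDeriv_fun_zero]
    simp only [Pi.zero_apply, norm_zero]
    positivity

lemma nearPt_mem_and_dist_le {k : ℕ} {z : Fin n → ℤ} {y : EuclideanSpace ℝ (Fin n)}
    (h : y ∈ tsupport (nearBump X k z)) :
    nearPt X k z ∈ X ∧ dist y (nearPt X k z) ≤ (3 * n + 1) * (1 / 2 : ℝ) ^ k := by
  by_cases hz : IsNear X k z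
  · rw [show nearBump X k z = latticeBump k z from funext fun y => if_pos hz] at h
    have hspec : nearPt X k z ∈ X ∧ ∀ i, |2 ^ k * nearPt X k z i - z i| ≤ 2 := by
      rw [nearPt, dif_pos hz]
      exact hz.choose_spec
    generalize nearPt X k z = x at hspec
    obtain ⟨hx, hxz⟩ := hspec
    refine ⟨hx, ?_⟩
    rw [dist_eq_norm]
    refine (norm_le_of_coord_le (a := 3 * (1 / 2 : ℝ) ^ k) fun i => ?_).trans ?_
    · have h1 := abs_sub_le_of_mem_tsupport h i
      have h2 := abs_sub (2 ^ k * y i - z i) (2 ^ k * x i - z i)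
      have h3 := hxz i
      have h4 : (2 : ℝ) ^ k * |y i - x i| ≤ 3 := by
        calc (2 : ℝ) ^ k * |y i - x i| = |(2 : ℝ) ^ k * (y i - x i)| := by
              rw [abs_mul, abs_of_pos (show (0 : ℝ) < 2 ^ k by positivity)]
          _ = |(2 ^ k * y i - z i) - (2 ^ k * x i - z i)| := by ring_nf
          _ ≤ 3 := by linarith
      rw [one_div, inv_pow, ← div_eq_mul_inv, le_div_iff₀ (by positivity), mul_comm]
      exact h4
    · have : (0 : ℝ) < (1 / 2 : ℝ) ^ k := by positivity
      linarith
  · rw [show nearBump X k z = fun _ => 0 from funext fun y => if_neg hz] at h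
    simp at h

lemma cutoff_eq_sum {k R : ℕ} {y : EuclideanSpace ℝ (Fin n)} (hy : ‖y‖ ≤ R) :
    cutoff X k y = ∑ z ∈ latticeBox n k R, nearBump X k z y :=
  finsum_eq_sum_of_support_subset _ fun _ hz =>
    mem_latticeBox hy (latticeBump_ne_zero_of_nearBump hz)

lemma stageFun_eq_sum {k R : ℕ} {y : EuclideanSpace ℝ (Fin n)} (hy : ‖y‖ ≤ R) :
    stageFun X F k y
      = ∑ z ∈ latticeBox n k R, nearBump X k z y * stagePoly F k (nearPt X k z) y :=
  finsum_eq_sum_of_support_subset _ fun _ hz =>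
    mem_latticeBox hy (latticeBump_ne_zero_of_nearBump (left_ne_zero_of_mul hz))

lemma cutoff_eq_one {k : ℕ} {x y : EuclideanSpace ℝ (Fin n)} (hx : x ∈ X)
    (hxy : dist y x ≤ (1 / 2 : ℝ) ^ k) : cutoff X k y = 1 := by
  obtain ⟨R, hR⟩ := exists_nat_ge ‖y‖
  rw [cutoff_eq_sum hR, ← sum_latticeBump (k := k) hR]
  refine Finset.sum_congr rfl fun z _ => ?_
  by_cases hz : latticeBump k z y = 0
  · simp [nearBump, hz]
  refine if_pos ⟨x, hx, fun i => ?_⟩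
  have h1 := abs_sub_le_of_latticeBump_ne_zero hz i
  have h2 : |y i - x i| ≤ (1 / 2 : ℝ) ^ k := by
    refine le_trans ?_ hxy
    rw [dist_eq_norm]
    exact PiLp.norm_apply_le (y - x) i
  have h3 : |(2 : ℝ) ^ k * (y i - x i)| ≤ 1 := by
    rw [abs_mul, abs_of_pos (by positivity)]
    calc _ ≤ (2 : ℝ) ^ k * (1 / 2 : ℝ) ^ k := by gcongr
      _ = 1 := by rw [← mul_pow]; norm_num
  rw [abs_le] at *
  constructor <;> linarith

lemma contDiff_of_eq_on_balls {E : Type*} [NormedAddCommGroup E] [NormedSpace ℝ E] {f : E → ℝ}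
    (h : ∀ R : ℕ, ∃ g : E → ℝ, ContDiff ℝ (⊤ : ℕ∞) g ∧ ∀ y, ‖y‖ ≤ R → f y = g y) :
    ContDiff ℝ (⊤ : ℕ∞) f := by
  rw [contDiff_iff_contDiffAt]
  intro x
  obtain ⟨R, hR⟩ := exists_nat_gt ‖x‖
  obtain ⟨g, hg, hfg⟩ := h R
  refine hg.contDiffAt.congr_of_eventuallyEq ?_
  filter_upwards [continuous_norm.continuousAt.eventually_lt_const hR] with y hy
  exact hfg y hy.le

lemma contDiff_cutoff (k : ℕ) : ContDiff ℝ (⊤ : ℕ∞) (cutoff X k) :=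
  contDiff_of_eq_on_balls fun R => ⟨fun y => ∑ z ∈ latticeBox n k R, nearBump X k z y,
    ContDiff.sum fun z _ => contDiff_nearBump k z, fun _ hy => cutoff_eq_sum hy⟩

lemma contDiff_stageFun (k : ℕ) : ContDiff ℝ (⊤ : ℕ∞) (stageFun X F k) :=
  contDiff_of_eq_on_balls fun R =>
    ⟨fun y => ∑ z ∈ latticeBox n k R, nearBump X k z y * stagePoly F k (nearPt X k z) y,
    ContDiff.sum fun z _ => (contDiff_nearBump k z).mul (contDiff_stagePoly _ _ _),
    fun _ hy => stageFun_eq_sum hy⟩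

lemma contDiff_stageStep (k : ℕ) : ContDiff ℝ (⊤ : ℕ∞) (stageStep X F k) :=
  ((contDiff_cutoff k).mul (contDiff_stageFun (k + 1))).sub
    ((contDiff_cutoff (k + 1)).mul (contDiff_stageFun k))

lemma stageStep_eq_sum {k R : ℕ} {y : EuclideanSpace ℝ (Fin n)} (hy : ‖y‖ ≤ R) :
    stageStep X F k y = ∑ z ∈ latticeBox n k R, ∑ w ∈ latticeBox n (k + 1) R,
      nearBump X k z y * (nearBump X (k + 1) w y *
        (stagePoly F (k + 1) (nearPt X (k + 1) w) y - stagePoly F k (nearPt X k z) y)) := by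
  rw [stageStep, cutoff_eq_sum hy, cutoff_eq_sum hy, stageFun_eq_sum hy, stageFun_eq_sum hy,
    Finset.sum_mul_sum, mul_comm, Finset.sum_mul_sum, ← Finset.sum_sub_distrib]
  refine Finset.sum_congr rfl fun z _ => ?_
  rw [← Finset.sum_sub_distrib]
  exact Finset.sum_congr rfl fun w _ => by ring

lemma stageStep_eq_of_dist_le {k : ℕ} {x y : EuclideanSpace ℝ (Fin n)} (hx : x ∈ X)
    (hxy : dist y x ≤ (1 / 2 : ℝ) ^ (k + 1)) :
    stageStep X F k y = stageFun X F (k + 1) y - stageFun X F k y := by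
  rw [stageStep, cutoff_eq_one hx hxy, cutoff_eq_one hx (hxy.trans
    (pow_le_pow_of_le_one (by norm_num) (by norm_num) k.le_succ)), one_mul, one_mul]

lemma iteratedFDeriv_congr_of_norm_lt {f g : EuclideanSpace ℝ (Fin n) → ℝ} {R : ℝ}
    (h : ∀ y, ‖y‖ ≤ R → f y = g y) {y : EuclideanSpace ℝ (Fin n)} (hy : ‖y‖ < R) (j : ℕ) :
    iteratedFDeriv ℝ j f y = iteratedFDeriv ℝ j g y := by
  refine (EventuallyEq.iteratedFDeriv ℝ ?_ j).eq_of_nhds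
  filter_upwards [continuous_norm.continuousAt.eventually_lt_const hy] with z hz
  exact h z hz.le

variable {K : Set (EuclideanSpace ℝ (Fin n))} {p : EuclideanSpace ℝ (Fin n)} {ρ : ℝ}

lemma rapidDecay_stageStep (hK : IsCompact K) (hF : ∀ α, ContinuousOn (F α) K)
    (hW : ∀ M : ℕ, ∀ β : Fin n → ℕ, (∑ i, β i) ≤ M →
      ∀ ε > (0:ℝ), ∃ δ > (0:ℝ), ∀ x ∈ K, ∀ y ∈ K, 0 < dist x y → dist x y ≤ δ →
      |taylorRem M F β x y| ≤ ε * dist x y ^ (M - ∑ i, β i))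
    (hρ : 0 < ρ) (hXK : ∀ x ∈ X, dist x p ≤ 2 * ρ → x ∈ K) (j : ℕ) :
    RapidDecay (fun _ y => y ∈ Metric.ball p ρ)
      (fun k y => ‖iteratedFDeriv ℝ j (stageStep X F k) y‖) := by
  obtain ⟨R, hR⟩ := exists_nat_ge (‖p‖ + ρ)
  have hball : ∀ y ∈ Metric.ball p ρ, ‖y‖ < R := fun y hy => by
    rw [Metric.mem_ball, dist_eq_norm] at hy
    have := norm_le_insert' y p
    linarith
  set c : ℝ := 3 * n + 1 with hc
  have hc0 : 0 < c := by positivity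
  have hpt : ∀ {k z y}, y ∈ Metric.ball p ρ → c * (1 / 2 : ℝ) ^ k ≤ ρ →
      y ∈ tsupport (nearBump X k z) →
      nearPt X k z ∈ K ∧ dist y (nearPt X k z) ≤ c * (1 / 2 : ℝ) ^ k := by
    intro k z y hy hk h
    obtain ⟨h1, h2⟩ := nearPt_mem_and_dist_le h
    refine ⟨hXK _ h1 ?_, h2⟩
    have := dist_triangle_left (nearPt X k z) p y
    rw [Metric.mem_ball] at hy
    linarith
  have hcard : ∀ k, ((latticeBox n (k + 1) R).card : ℝ)
      ≤ ((2 * R + 3) ^ n * 2 ^ n) * ((2 : ℝ) ^ k) ^ n := fun k => by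
    refine (card_latticeBox_le n (k + 1) R).trans_eq ?_
    rw [pow_succ, mul_pow]
    ring
  have hwt : ∀ j : ℕ, ∃ C ≥ (0 : ℝ), ∃ A : ℕ, ∀ k z x,
      ‖iteratedFDeriv ℝ j (nearBump X (k + 1) z) x‖ ≤ C * ((2 : ℝ) ^ k) ^ A := fun j => by
    obtain ⟨C, hC, A, h⟩ := exists_bound_iteratedFDeriv_nearBump X j
    refine ⟨C * 2 ^ A, by positivity, A, fun k z x => (h _ _ _).trans_eq ?_⟩
    rw [pow_succ, mul_pow]
    ring
  have key : RapidDecay (fun k y => y ∈ Metric.ball p ρ ∧ c * (1 / 2 : ℝ) ^ k ≤ ρ)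
      (fun k y => ‖iteratedFDeriv ℝ j (fun x => ∑ z ∈ latticeBox n k R,
        ∑ w ∈ latticeBox n (k + 1) R, nearBump X k z x * (nearBump X (k + 1) w x *
          (stagePoly F (k + 1) (nearPt X (k + 1) w) x - stagePoly F k (nearPt X k z) x))) y‖) := by
    have hsub : ∀ k z w, ContDiff ℝ (⊤ : ℕ∞) (fun x =>
        stagePoly F (k + 1) (nearPt X (k + 1) w) x - stagePoly F k (nearPt X k z) x) :=
      fun k z w => (contDiff_stagePoly _ _ _).sub (contDiff_stagePoly _ _ _)
    have hmul : ∀ k z w, ContDiff ℝ (⊤ : ℕ∞) (fun x => nearBump X (k + 1) w x *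
        (stagePoly F (k + 1) (nearPt X (k + 1) w) x - stagePoly F k (nearPt X k z) x)) :=
      fun k z w => (contDiff_nearBump _ _).mul (hsub k z w)
    refine RapidDecay.sum_smooth (J := EuclideanSpace ℝ (Fin n)) (ι := (Fin n → ℤ))
      (D := fun k y => y ∈ Metric.ball p ρ ∧ c * (1 / 2 : ℝ) ^ k ≤ ρ) (y := fun _ y => y)
      (φ := fun k z _ x => ∑ w ∈ latticeBox n (k + 1) R, nearBump X k z x *
        (nearBump X (k + 1) w x *
          (stagePoly F (k + 1) (nearPt X (k + 1) w) x - stagePoly F k (nearPt X k z) x)))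
      (fun k => card_latticeBox_le n k R)
      (fun k z _ => ContDiff.sum fun w _ => (contDiff_nearBump k z).mul (hmul k z w)) j ?_
    refine RapidDecay.sum_smooth (J := (Fin n → ℤ) × EuclideanSpace ℝ (Fin n)) (ι := (Fin n → ℤ))
      (D := fun k s => s.2 ∈ Metric.ball p ρ ∧ c * (1 / 2 : ℝ) ^ k ≤ ρ) (y := fun _ s => s.2)
      (φ := fun k w s x => nearBump X k s.1 x * (nearBump X (k + 1) w x *
          (stagePoly F (k + 1) (nearPt X (k + 1) w) x - stagePoly F k (nearPt X k s.1) x)))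
      (S := fun k => latticeBox n (k + 1) R)
      hcard
      (fun k w s => (contDiff_nearBump k s.1).mul (hmul k s.1 w)) j ?_
    refine RapidDecay.mul_smooth (J := (Fin n → ℤ) × (Fin n → ℤ) × EuclideanSpace ℝ (Fin n))
      (D' := fun k s => s.2.2 ∈ Metric.ball p ρ ∧ c * (1 / 2 : ℝ) ^ k ≤ ρ)
      (y := fun _ s => s.2.2) (w := fun k s => nearBump X k s.2.1)
      (Q := fun k s x => nearBump X (k + 1) s.1 x *
          (stagePoly F (k + 1) (nearPt X (k + 1) s.1) x - stagePoly F k (nearPt X k s.2.1) x))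
      (D := fun k s => s.2.2 ∈ Metric.ball p ρ ∧ c * (1 / 2 : ℝ) ^ k ≤ ρ ∧
        nearPt X k s.2.1 ∈ K ∧ dist s.2.2 (nearPt X k s.2.1) ≤ c * (1 / 2 : ℝ) ^ k)
      (fun k s => contDiff_nearBump k _) (fun k s => hmul k _ _) ?_ ?_ ?_ j
    · intro j
      obtain ⟨C, hC, A, h⟩ := exists_bound_iteratedFDeriv_nearBump X j
      exact ⟨C, hC, A, fun k s x => h k _ x⟩
    · refine RapidDecay.mul_smooth (J := (Fin n → ℤ) × (Fin n → ℤ) × EuclideanSpace ℝ (Fin n))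
        (D' := fun k s => s.2.2 ∈ Metric.ball p ρ ∧ c * (1 / 2 : ℝ) ^ k ≤ ρ ∧
          nearPt X k s.2.1 ∈ K ∧ dist s.2.2 (nearPt X k s.2.1) ≤ c * (1 / 2 : ℝ) ^ k)
        (y := fun _ s => s.2.2)
        (w := fun k s => nearBump X (k + 1) s.1)
        (Q := fun k s x =>
          stagePoly F (k + 1) (nearPt X (k + 1) s.1) x - stagePoly F k (nearPt X k s.2.1) x)
        (D := fun k s => nearPt X k s.2.1 ∈ K ∧ nearPt X (k + 1) s.1 ∈ K ∧
          dist s.2.2 (nearPt X k s.2.1) ≤ c * (1 / 2 : ℝ) ^ k ∧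
          dist s.2.2 (nearPt X (k + 1) s.1) ≤ c * (1 / 2 : ℝ) ^ (k + 1))
        (fun k s => contDiff_nearBump _ _) (fun k s => hsub k _ _) ?_ ?_ ?_
      · intro j
        obtain ⟨C, hC, A, h⟩ := hwt j
        exact ⟨C, hC, A, fun k s x => h k _ x⟩
      · intro j N
        filter_upwards [rapidDecay_stagePoly_sub hK hF hW hc0 Nat.le_succ j N] with k h s hs
        exact h (nearPt X k s.2.1, nearPt X (k + 1) s.1, s.2.2) hs
      · rintro k s ⟨h1, h2, h3, h4⟩ hs
        have h5 := hpt h1 (le_trans (by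
          gcongr ?_ * ?_
          exact pow_le_pow_of_le_one (by norm_num) (by norm_num) k.le_succ) h2) hs
        exact ⟨h3, h5.1, h4, h5.2⟩
    · rintro k s ⟨h1, h2⟩ hs
      exact ⟨h1, h2, hpt h1 h2 hs⟩
  intro N
  filter_upwards [key N, eventually_mul_half_pow_le_const c hρ] with k h1 h2 y hy
  rw [iteratedFDeriv_congr_of_norm_lt (fun y hy => stageStep_eq_sum hy) (hball y hy) j]
  exact h1 y ⟨hy, h2⟩

lemma rapidDecay_stageFun_sub (hK : IsCompact K) (hF : ∀ α, ContinuousOn (F α) K)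
    (hW : ∀ M : ℕ, ∀ β : Fin n → ℕ, (∑ i, β i) ≤ M →
      ∀ ε > (0:ℝ), ∃ δ > (0:ℝ), ∀ x ∈ K, ∀ y ∈ K, 0 < dist x y → dist x y ≤ δ →
      |taylorRem M F β x y| ≤ ε * dist x y ^ (M - ∑ i, β i))
    (hρ : 0 < ρ) (hp : p ∈ X) (hXK : ∀ x ∈ X, dist x p ≤ 2 * ρ → x ∈ K) (j : ℕ) :
    RapidDecay (fun _ (_ : Unit) => True)
      (fun k _ => ‖iteratedFDeriv ℝ j (fun y => stageFun X F k y - stagePoly F k p y) p‖) := by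
  obtain ⟨R, hR⟩ := exists_nat_gt ‖p‖
  set c : ℝ := 3 * n + 1 with hc
  have hc0 : 0 < c := by positivity
  have hsub : ∀ k z, ContDiff ℝ (⊤ : ℕ∞) (fun x =>
      stagePoly F k (nearPt X k z) x - stagePoly F k p x) :=
    fun k z => (contDiff_stagePoly _ _ _).sub (contDiff_stagePoly _ _ _)
  have key : RapidDecay (fun k (_ : Unit) => c * (1 / 2 : ℝ) ^ k ≤ ρ)
      (fun k _ => ‖iteratedFDeriv ℝ j (fun x => ∑ z ∈ latticeBox n k R,
        nearBump X k z x * (stagePoly F k (nearPt X k z) x - stagePoly F k p x)) p‖) := by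
    refine RapidDecay.sum_smooth (J := Unit) (ι := (Fin n → ℤ))
      (D := fun k _ => c * (1 / 2 : ℝ) ^ k ≤ ρ) (y := fun _ _ => p)
      (φ := fun k z _ x =>
        nearBump X k z x * (stagePoly F k (nearPt X k z) x - stagePoly F k p x))
      (fun k => card_latticeBox_le n k R)
      (fun k z _ => (contDiff_nearBump k z).mul (hsub k z)) j ?_
    refine RapidDecay.mul_smooth (J := (Fin n → ℤ) × Unit)
      (D' := fun k _ => c * (1 / 2 : ℝ) ^ k ≤ ρ)
      (y := fun _ _ => p) (w := fun k s => nearBump X k s.1)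
      (Q := fun k s x => stagePoly F k (nearPt X k s.1) x - stagePoly F k p x)
      (D := fun k s => nearPt X k s.1 ∈ K ∧ dist p (nearPt X k s.1) ≤ c * (1 / 2 : ℝ) ^ k)
      (fun k s => contDiff_nearBump k _) (fun k s => hsub k _) ?_ ?_ ?_ j
    · intro j
      obtain ⟨C, hC, A, h⟩ := exists_bound_iteratedFDeriv_nearBump X j
      exact ⟨C, hC, A, fun k s x => h k _ x⟩
    · intro j N
      filter_upwards [rapidDecay_stagePoly_sub hK hF hW hc0 (σ := id) (fun _ => le_rfl) j N]
        with k h s hs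
      refine h (p, nearPt X k s.1, p) ⟨hXK p hp ?_, hs.1, ?_, hs.2⟩
      · rw [dist_self]; positivity
      · dsimp only
        rw [dist_self]; positivity
    · intro k s hk hs
      obtain ⟨h1, h2⟩ := nearPt_mem_and_dist_le hs
      refine ⟨hXK _ h1 ?_, h2⟩
      rw [dist_comm]
      linarith
  intro N
  filter_upwards [key N, eventually_mul_half_pow_le_const c hρ] with k h1 h2 u _
  refine le_of_eq_of_le ?_ (h1 u h2)
  congr 1
  refine (EventuallyEq.iteratedFDeriv ℝ ?_ j).eq_of_nhds
  filter_upwards [continuous_norm.continuousAt.eventually_lt_const hR,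
    Metric.closedBall_mem_nhds p (show (0 : ℝ) < (1 / 2) ^ k by positivity)] with y hy hyp
  have h3 := cutoff_eq_one hp (Metric.mem_closedBall.1 hyp)
  rw [cutoff_eq_sum hy.le] at h3
  simp only [mul_sub, Finset.sum_sub_distrib]
  rw [← Finset.sum_mul, h3, one_mul, stageFun_eq_sum hy.le]

end

lemma exists_compact_chart {n : ℕ} {U X : Set (EuclideanSpace ℝ (Fin n))}
    (hU : IsOpen U) (hrc : closure X ∩ U = X) {p : EuclideanSpace ℝ (Fin n)} (hp : p ∈ U) :
    ∃ ρ > (0 : ℝ), ∃ K ⊆ X, IsCompact K ∧ ∀ x ∈ X, dist x p ≤ 2 * ρ → x ∈ K := by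
  obtain ⟨r, hr, hrU⟩ := Metric.nhds_basis_closedBall.mem_iff.1 (hU.mem_nhds hp)
  refine ⟨r / 2, by positivity, closure X ∩ Metric.closedBall p r, fun x hx => ?_,
    (isCompact_closedBall p r).inter_left isClosed_closure,
    fun x hx hxp => ⟨subset_closure hx, ?_⟩⟩
  · exact hrc.subset ⟨hx.1, hrU hx.2⟩
  · rw [Metric.mem_closedBall]
    linarith

section
variable {n : ℕ} {X K : Set (EuclideanSpace ℝ (Fin n))}
  {F : (Fin n → ℕ) → EuclideanSpace ℝ (Fin n) → ℝ} {p : EuclideanSpace ℝ (Fin n)} {ρ : ℝ}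

lemma IsWhitney.uniform (hF : ∀ m : ℕ, IsWhitney m X F) (hK : IsCompact K) (hKX : K ⊆ X)
    (M : ℕ) (β : Fin n → ℕ) (hβ : (∑ i, β i) ≤ M) :
      ∀ ε > (0:ℝ), ∃ δ > (0:ℝ), ∀ x ∈ K, ∀ y ∈ K, 0 < dist x y → dist x y ≤ δ →
      |taylorRem M F β x y| ≤ ε * dist x y ^ (M - ∑ i, β i) :=
  (hF M).2 K hK hKX β hβ

lemma IsWhitney.continuousOn (hF : ∀ m : ℕ, IsWhitney m X F) (hKX : K ⊆ X)
    (α : Fin n → ℕ) : ContinuousOn (F α) K :=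
  ((hF _).1 α le_rfl).mono hKX

lemma smooth_tsum_stageStep (hF : ∀ m : ℕ, IsWhitney m X F) (hK : IsCompact K) (hKX : K ⊆ X)
    (hρ : 0 < ρ) (hXK : ∀ x ∈ X, dist x p ≤ 2 * ρ → x ∈ K) :
    ContDiffOn ℝ (⊤ : ℕ∞) (fun y => ∑' k, stageStep X F k y) (Metric.ball p ρ) ∧
      ∀ j, ∀ y ∈ Metric.ball p ρ, HasSum (fun k => iteratedFDeriv ℝ j (stageStep X F k) y)
        (iteratedFDeriv ℝ j (fun y => ∑' k, stageStep X F k y) y) := by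
  refine smooth_tsum_ball contDiff_stageStep hρ fun j => ?_
  filter_upwards [rapidDecay_stageStep hK (IsWhitney.continuousOn hF hKX)
    (IsWhitney.uniform hF hK hKX) hρ hXK j 1] with k hk y hy
  simpa using hk y hy

lemma tendsto_iteratedFDeriv_stageFun (hF : ∀ m : ℕ, IsWhitney m X F) (hK : IsCompact K)
    (hKX : K ⊆ X) (hρ : 0 < ρ) (hp : p ∈ X) (hXK : ∀ x ∈ X, dist x p ≤ 2 * ρ → x ∈ K) (k : ℕ)
    (j : Fin k → Fin n) :
    Tendsto (fun N => iteratedFDeriv ℝ k (stageFun X F N) p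
      (fun l => EuclideanSpace.single (j l) 1)) atTop (𝓝 (F (countIdx j) p)) := by
  have hpK : p ∈ K := hXK p hp (by rw [dist_self]; positivity)
  have h0 : Tendsto (fun N => iteratedFDeriv ℝ k
      (fun y => stageFun X F N y - stagePoly F N p y) p) atTop (𝓝 0) := by
    rw [tendsto_zero_iff_norm_tendsto_zero]
    refine squeeze_zero' (.of_forall fun _ => norm_nonneg _) ?_
      (tendsto_pow_atTop_nhds_zero_of_lt_one (r := (1 / 2 : ℝ)) (by norm_num) (by norm_num))
    filter_upwards [rapidDecay_stageFun_sub hK (IsWhitney.continuousOn hF hKX)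
      (IsWhitney.uniform hF hK hKX) hρ hp hXK k 1] with N hN
    simpa using hN () trivial
  have h1 := (((ContinuousMultilinearMap.apply ℝ (fun _ : Fin k => EuclideanSpace ℝ (Fin n)) ℝ
    (fun l => EuclideanSpace.single (j l) 1)).continuous.tendsto 0).comp h0).add_const
      (F (countIdx j) p)
  rw [map_zero, zero_add] at h1
  refine h1.congr' ?_
  filter_upwards [eventually_truncCoeff_eq hK (IsWhitney.continuousOn hF hKX) k,
    eventually_ge_atTop k] with N hN hkN
  have h2 : iteratedFDeriv ℝ k (stagePoly F N p) p (fun l => EuclideanSpace.single (j l) 1)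
      = F (countIdx j) p := by
    rw [show stagePoly F N p = fun y => taylorPoly N (truncCoeff F N p) (y - p) from rfl,
      iteratedFDeriv_taylorPoly, if_pos hkN, sub_self, taylorPoly_zero, zero_add,
      hN _ (sum_countIdx j).le p hpK]
  rw [Function.comp_apply, ContinuousMultilinearMap.apply_apply, fun_iteratedFDeriv_sub_apply
    ((contDiff_stageFun N).of_le (natCast_lt_infty k).le).contDiffAt
    ((contDiff_stagePoly F N p).of_le (natCast_lt_infty k).le).contDiffAt, sub_apply, h2,
    sub_add_cancel]

lemma iteratedFDeriv_jetExtension (hF : ∀ m : ℕ, IsWhitney m X F) (hK : IsCompact K)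
    (hKX : K ⊆ X) (hρ : 0 < ρ) (hp : p ∈ X) (hXK : ∀ x ∈ X, dist x p ≤ 2 * ρ → x ∈ K) (k : ℕ)
    (j : Fin k → Fin n) :
    iteratedFDeriv ℝ k (jetExtension X F) p (fun l => EuclideanSpace.single (j l) 1)
      = F (countIdx j) p := by
  have hcs : ∀ N, ContDiffAt ℝ k (stageFun X F N) p := fun N =>
    ((contDiff_stageFun N).of_le (natCast_lt_infty k).le).contDiffAt
  obtain ⟨hs, hsum⟩ := smooth_tsum_stageStep hF hK hKX hρ hXK
  have hpb := Metric.mem_ball_self (x := p) hρ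
  have hstep : ∀ N, iteratedFDeriv ℝ k (stageStep X F N) p
      = iteratedFDeriv ℝ k (stageFun X F (N + 1)) p - iteratedFDeriv ℝ k (stageFun X F N) p := by
    intro N
    rw [← fun_iteratedFDeriv_sub_apply (hcs _) (hcs _)]
    refine (EventuallyEq.iteratedFDeriv ℝ ?_ k).eq_of_nhds
    filter_upwards [Metric.closedBall_mem_nhds p
      (show (0 : ℝ) < (1 / 2) ^ (N + 1) by positivity)] with y hy
    exact stageStep_eq_of_dist_le hp hy
  have hlim := (hsum k p hpb).tendsto_sum_nat
  simp only [hstep, Finset.sum_range_sub (fun N => iteratedFDeriv ℝ k (stageFun X F N) p)] at hlim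
  have hadd : iteratedFDeriv ℝ k (jetExtension X F) p = iteratedFDeriv ℝ k (stageFun X F 0) p
      + iteratedFDeriv ℝ k (fun y => ∑' k, stageStep X F k y) p :=
    fun_iteratedFDeriv_add_apply (hcs 0)
      ((hs.contDiffAt (Metric.isOpen_ball.mem_nhds hpb)).of_le (natCast_lt_infty k).le)
  have hlim' := hlim.const_add (iteratedFDeriv ℝ k (stageFun X F 0) p)
  simp only [add_sub_cancel, ← hadd] at hlim'
  exact tendsto_nhds_unique
    (((ContinuousMultilinearMap.apply ℝ (fun _ : Fin k => EuclideanSpace ℝ (Fin n)) ℝ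
      (fun l => EuclideanSpace.single (j l) 1)).continuous.tendsto _).comp hlim')
    (tendsto_iteratedFDeriv_stageFun hF hK hKX hρ hp hXK k j)

end

/-- Whitney Extension Theorem, infinite order: if every truncation of the jet `F` is a Whitney
function of class `m` on the nonempty relatively closed subset `X` of the open set `U ⊆ ℝⁿ`,
then there is `f ∈ C^∞(U)` all of whose partial derivatives on `X` coincide with the components
of `F`. -/
theorem whitney_extension_infinite {n : ℕ} (U X : Set (EuclideanSpace ℝ (Fin n)))
    (hU : IsOpen U) (hXU : X ⊆ U) (hrc : closure X ∩ U = X) (hne : X.Nonempty)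
    (F : (Fin n → ℕ) → EuclideanSpace ℝ (Fin n) → ℝ)
    (hF : ∀ m : ℕ, IsWhitney m X F) :
    ∃ f : EuclideanSpace ℝ (Fin n) → ℝ, ContDiffOn ℝ (⊤ : ℕ∞) f U ∧
      ∀ k : ℕ, ∀ j : Fin k → Fin n, ∀ x ∈ X,
        iteratedFDerivWithin ℝ k f U x (fun l => EuclideanSpace.single (j l) 1)
          = F (fun i => (Finset.univ.filter (fun l => j l = i)).card) x := by
  refine ⟨jetExtension X F, fun p hp => ?_, fun k j x hx => ?_⟩
  · obtain ⟨ρ, hρ, K, hKX, hK, hXK⟩ := exists_compact_chart hU hrc hp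
    refine ContDiffAt.contDiffWithinAt ?_
    exact (contDiff_stageFun 0).contDiffAt.add
      ((smooth_tsum_stageStep hF hK hKX hρ hXK).1.contDiffAt
        (Metric.isOpen_ball.mem_nhds (Metric.mem_ball_self hρ)))
  · obtain ⟨ρ, hρ, K, hKX, hK, hXK⟩ := exists_compact_chart hU hrc (hXU hx)
    rw [iteratedFDerivWithin_of_isOpen k hU (hXU hx)]
    exact iteratedFDeriv_jetExtension hF hK hKX hρ hx hXK k j
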